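/- Let P_1, …, P_m be a Clifford system of signature (m, r) on ℝ^{2l}_s with m ≡ 0 (mod 4) and r ≡ 0 (mod 2), and set P := P_1P_2⋯P_m and Σ := span_ℝ{P_1, …, P_m}. Suppose x ∈ M_+ and v ∈ ℝ^{2l} satisfy ⟨v, v⟩ > 0 and, for every i ∈ {1, …, m}, there exists Q_i ∈ Σ with trace(Q_iP_i) = 0 and v = Q_iP_ix. Then Px = x or Px = −x, i.e. x ∈ E_+(P) ∪ E_−(P). -/

import Mathlib

open Matrix

noncomputable section

/-- Entries of the signature matrix `J_{r,m-r}`, with 1-based indices: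
`η_{ii} = -1` for `1 ≤ i ≤ r` and `η_{ii} = 1` for `r < i`; off-diagonal entries vanish. -/
def cliffEta (r i j : ℕ) : ℝ :=
  if i = j then (if i ≤ r then -1 else 1) else 0

/-- The matrix `J_{s,n-s} = diag(-E_s, E_{n-s})`. -/
def psJ (n s : ℕ) : Matrix (Fin n) (Fin n) ℝ :=
  Matrix.diagonal fun i => if (i : ℕ) < s then (-1 : ℝ) else 1

/-- The pseudo-inner product `⟨u, v⟩ = uᵀ J_{s,n-s} v` of `ℝ^n_s`. -/
def psInner (n s : ℕ) (u v : Fin n → ℝ) : ℝ :=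
  u ⬝ᵥ ((psJ n s) *ᵥ v)

/-- A Clifford system of signature `(m, r)` on `ℝ^{2l}_s`, indexed by `1, …, m`:
each `P i` is symmetric with respect to the pseudo-inner product, and
`P i * P j + P j * P i = 2 η_{ij} E_{2l}`. -/
def IsCliffordSystem (l s m r : ℕ)
    (P : ℕ → Matrix (Fin (2 * l)) (Fin (2 * l)) ℝ) : Prop :=
  (∀ i ∈ Finset.Icc 1 m, (P i)ᵀ = psJ (2 * l) s * P i * psJ (2 * l) s) ∧
  (∀ i ∈ Finset.Icc 1 m, ∀ j ∈ Finset.Icc 1 m,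
    P i * P j + P j * P i
      = (2 * cliffEta r i j) • (1 : Matrix (Fin (2 * l)) (Fin (2 * l)) ℝ))

theorem ofFn_prod_adj_swap {R : Type*} [Ring R] (n : ℕ) :
    ∀ (a : Fin (n + 1) → R) (_ : ∀ i j, i ≠ j → a i * a j = -(a j * a i)) (i : Fin n),
      (List.ofFn (a ∘ Equiv.swap i.castSucc i.succ)).prod = -(List.ofFn a).prod := by
  induction n with
  | zero => intro a _ i; exact i.elim0
  | succ n ih =>
    intro a ha i
    refine Fin.cases ?_ (fun j => ?_) i
    · have h1 : ∀ k : Fin n, Equiv.swap (0 : Fin (n + 2)) 1 k.succ.succ = k.succ.succ := by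
        intro k
        apply Equiv.swap_apply_of_ne_of_ne
        · exact Fin.succ_ne_zero _
        · intro h
          have := congrArg Fin.val h
          simp at this
      have h01 : a 0 * a 1 = -(a 1 * a 0) := ha 0 1 (by simp)
      simp only [List.ofFn_succ, List.prod_cons, Function.comp, Fin.castSucc_zero,
        Fin.succ_zero_eq_one, Equiv.swap_apply_left, Equiv.swap_apply_right, h1]
      rw [← mul_assoc, ← mul_assoc, h01]
      simp
    · have h0 : Equiv.swap (j.succ.castSucc) (j.succ.succ) 0 = (0 : Fin (n + 2)) := by
        apply Equiv.swap_apply_of_ne_of_ne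
        · intro h
          have := congrArg Fin.val h
          simp at this
        · exact (Fin.succ_ne_zero _).symm
      have h1 : ∀ k : Fin (n + 1), Equiv.swap (j.succ.castSucc) (j.succ.succ) k.succ
          = (Equiv.swap j.castSucc j.succ k).succ := by
        intro k
        rw [← Fin.succ_castSucc]
        exact ((Fin.succ_injective _).swap_apply _ _ _)
      have := ih (a ∘ Fin.succ) (fun p q hpq => ha _ _ (fun h => hpq (Fin.succ_injective _ h))) j
      rw [List.ofFn_succ, List.ofFn_succ (f := a), List.prod_cons, List.prod_cons]
      simp only [Function.comp_apply, h0, h1]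
      rw [← mul_neg]
      congr 1

theorem ofFn_prod_perm {R : Type*} [Ring R] (n : ℕ) (σ : Equiv.Perm (Fin n)) :
    ∀ (a : Fin n → R) (_ : ∀ i j, i ≠ j → a i * a j = -(a j * a i)),
      (List.ofFn (a ∘ σ)).prod = Equiv.Perm.sign σ • (List.ofFn a).prod := by
  cases n with
  | zero => intro a _; simp [Subsingleton.elim σ 1]
  | succ n =>
    have hσ : σ ∈ Submonoid.closure
        (Set.range fun i : Fin n => Equiv.swap i.castSucc i.succ) := by
      rw [Equiv.Perm.mclosure_swap_castSucc_succ]; trivial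
    induction hσ using Submonoid.closure_induction with
    | mem τ hτ =>
      obtain ⟨i, rfl⟩ := hτ
      intro a ha
      rw [ofFn_prod_adj_swap n a ha i, Equiv.Perm.sign_swap (Fin.castSucc_lt_succ).ne]
      simp
    | one => intro a _; simp
    | mul σ τ _ _ h1 h2 =>
      intro a ha
      have := h2 (a ∘ σ) (fun i j hij => ha _ _ (fun h => hij (σ.injective h)))
      rw [h1 a ha] at this
      rw [Equiv.Perm.coe_mul, ← Function.comp_assoc, this, smul_smul, Equiv.Perm.sign_mul, mul_comm]

theorem prod_eq_smul_of_anticomm {n m : ℕ}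
    (C : (Fin m → ℝ) →ₗ[ℝ] Matrix (Fin n) (Fin n) ℝ)
    (hC : ∀ i j : Fin m, i ≠ j → C (Pi.single i 1) * C (Pi.single j 1)
      = -(C (Pi.single j 1) * C (Pi.single i 1)))
    (w : Fin m → (Fin m → ℝ))
    (hw : ∀ i j : Fin m, i ≠ j → C (w i) * C (w j) = -(C (w j) * C (w i))) :
    ∃ d : ℝ, (List.ofFn fun i => C (w i)).prod
      = d • (List.ofFn fun i : Fin m => C (Pi.single i 1)).prod := by
  let f := MultilinearMap.alternatization
    ((MultilinearMap.mkPiAlgebraFin ℝ m (Matrix (Fin n) (Fin n) ℝ)).compLinearMap (fun _ => C))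
  have hf : ∀ u : Fin m → (Fin m → ℝ),
      (∀ i j : Fin m, i ≠ j → C (u i) * C (u j) = -(C (u j) * C (u i))) →
      f u = (m.factorial : ℝ) • (List.ofFn fun i => C (u i)).prod := by
    intro u hu
    have h : ∀ σ : Equiv.Perm (Fin m), Equiv.Perm.sign σ •
        (List.ofFn ((fun i => C (u i)) ∘ σ)).prod = (List.ofFn fun i => C (u i)).prod := by
      intro σ
      rw [ofFn_prod_perm m σ _ hu, smul_smul, Int.units_mul_self, one_smul]
    simp only [f, MultilinearMap.alternatization_apply, MultilinearMap.domDomCongr_apply,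
      MultilinearMap.compLinearMap_apply, MultilinearMap.mkPiAlgebraFin_apply]
    refine (Finset.sum_congr rfl (fun σ _ => h σ)).trans ?_
    simp [Fintype.card_perm, Nat.cast_smul_eq_nsmul]
  let b := Pi.basisFun ℝ (Fin m)
  refine ⟨b.det w, ?_⟩
  have h1 : f w = b.det w • f (fun i => Pi.single i 1) := by
    ext i j
    have := AlternatingMap.eq_smul_basis_det b
      ((Matrix.entryLinearMap ℝ ℝ i j).compAlternatingMap f)
    have h2 := congrArg (fun g => g w) this
    have h3 : (b : Fin m → (Fin m → ℝ)) = fun i => Pi.single i 1 := by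
      funext i; simp [b]
    simp only [LinearMap.compAlternatingMap_apply, AlternatingMap.smul_apply, h3,
      Matrix.entryLinearMap_apply, smul_eq_mul] at h2
    rw [h2, Matrix.smul_apply, smul_eq_mul, mul_comm]
  rw [hf w hw, hf _ hC, smul_comm] at h1
  exact smul_right_injective _ (by positivity : (m.factorial : ℝ) ≠ 0) h1

theorem span_orth {E : Type*} [AddCommGroup E] [Module ℝ E] (q : E →ₗ[ℝ] E →ₗ[ℝ] ℝ)
    (F : Set E) (f : E) (h : ∀ g ∈ F, q f g = 0) (s : E) (hs : s ∈ Submodule.span ℝ F) :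
    q f s = 0 := by
  have : Submodule.span ℝ F ≤ LinearMap.ker (q f) := Submodule.span_le.2 h
  exact this hs

theorem exists_proj {E : Type*} [AddCommGroup E] [Module ℝ E] (q : E →ₗ[ℝ] E →ₗ[ℝ] ℝ)
    (qs : ∀ u w, q u w = q w u) (u : E) (F : List E) :
    F.Pairwise (fun u w => q u w = 0) → (∀ f ∈ F, q f f ≠ 0) →
    ∃ s ∈ Submodule.span ℝ {f | f ∈ F}, ∀ f ∈ F, q (u - s) f = 0 := by
  induction F with
  | nil => intro _ _; exact ⟨0, Submodule.zero_mem _, by simp⟩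
  | cons f F ih =>
    intro hp hn
    rw [List.pairwise_cons] at hp
    obtain ⟨s, hs, h⟩ := ih hp.2 (fun g hg => hn g (List.mem_cons_of_mem _ hg))
    have hff := hn f List.mem_cons_self
    refine ⟨s + (q u f / q f f) • f, ?_, ?_⟩
    · apply Submodule.add_mem
      · exact Submodule.span_mono (fun g hg => List.mem_cons_of_mem _ hg) hs
      · exact Submodule.smul_mem _ _ (Submodule.subset_span List.mem_cons_self)
    · intro g hg
      rcases List.mem_cons.1 hg with rfl | hg
      · have := span_orth q _ g hp.1 s hs
        rw [qs] at this
        simp only [map_sub, map_add, map_smul, LinearMap.sub_apply, LinearMap.add_apply,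
          LinearMap.smul_apply, smul_eq_mul, this]
        field_simp
        ring
      · have h1 := h g hg
        have h2 := hp.1 g hg
        simp only [map_sub, map_add, map_smul, LinearMap.sub_apply, LinearMap.add_apply,
          LinearMap.smul_apply, smul_eq_mul] at h1 ⊢
        rw [h2]; linarith

theorem exists_ext {m : ℕ} (q : (Fin m → ℝ) →ₗ[ℝ] (Fin m → ℝ) →ₗ[ℝ] ℝ)
    (qs : ∀ u w, q u w = q w u) (qn : ∀ u, (∀ w, q u w = 0) → u = 0)
    (F : List (Fin m → ℝ)) (hp : F.Pairwise (fun u w => q u w = 0))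
    (hn : ∀ f ∈ F, q f f ≠ 0) (hl : F.length < m) :
    ∃ w, q w w ≠ 0 ∧ ∀ f ∈ F, q w f = 0 := by
  by_contra! hcon
  have hiso : ∀ w, (∀ f ∈ F, q w f = 0) → q w w = 0 := by
    intro w hw
    by_contra h
    obtain ⟨f, hf, hf'⟩ := hcon w h
    exact hf' (hw f hf)
  have hspan : Submodule.span ℝ {f | f ∈ F} = ⊤ := by
    rw [eq_top_iff]
    intro u _
    obtain ⟨s, hs, h⟩ := exists_proj q qs u F hp hn
    have : u - s = 0 := by
      apply qn
      intro t
      obtain ⟨s', hs', h'⟩ := exists_proj q qs t F hp hn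
      have h1 := span_orth q _ (u - s) h s' hs'
      have h2 := hiso _ h
      have h3 := hiso _ h'
      have h4 := hiso ((u - s) + (t - s')) (by
        intro f hf
        rw [map_add, LinearMap.add_apply, h f hf, h' f hf, add_zero])
      have h5 := qs (u - s) (t - s')
      have h6 : q (u - s) t = q (u - s) (t - s') + q (u - s) s' := by
        rw [← map_add]; simp
      simp only [map_add, LinearMap.add_apply] at h4
      linarith
    rw [sub_eq_zero.1 this]; exact hs
  classical
  have h1 := finrank_span_finset_le_card (R := ℝ) F.toFinset
  have h2 : ((F.toFinset : Finset (Fin m → ℝ)) : Set (Fin m → ℝ)) = {f | f ∈ F} := by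
    ext; simp
  rw [h2, Set.finrank, hspan, finrank_top, Module.finrank_fin_fun] at h1
  have := F.toFinset_card_le
  omega

theorem exists_pairs {m : ℕ} (q : (Fin m → ℝ) →ₗ[ℝ] (Fin m → ℝ) →ₗ[ℝ] ℝ)
    (qs : ∀ u w, q u w = q w u) (qn : ∀ u, (∀ w, q u w = 0) → u = 0)
    (A : (Fin m → ℝ) →ₗ[ℝ] (Fin m → ℝ)) (N : ℝ) (hN : N ≠ 0)
    (hsk : ∀ u w, q (A u) w = -q u (A w)) (hco : ∀ u w, q (A u) (A w) = N * q u w) (k : ℕ) :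
    2 * k ≤ m → ∃ L : List (Fin m → ℝ), L.length = k ∧ (∀ u ∈ L, q u u ≠ 0) ∧
      (L.flatMap fun u => [u, A u]).Pairwise (fun u w => q u w = 0) := by
  induction k with
  | zero => intro _; exact ⟨[], by simp⟩
  | succ k ih =>
    intro hk
    obtain ⟨L, hlen, hn, hp⟩ := ih (by omega)
    have hFn : ∀ f ∈ L.flatMap (fun u => [u, A u]), q f f ≠ 0 := by
      intro f hf
      rw [List.mem_flatMap] at hf
      obtain ⟨u, hu, hf⟩ := hf
      have := hn u hu
      simp only [List.mem_cons, List.not_mem_nil, or_false] at hf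
      rcases hf with rfl | rfl
      · exact this
      · rw [hco]; exact mul_ne_zero hN this
    obtain ⟨w, hw, hw'⟩ := exists_ext q qs qn _ hp hFn (by simp [hlen]; omega)
    refine ⟨w :: L, by simp [hlen], ?_, ?_⟩
    · intro u hu
      rcases List.mem_cons.1 hu with rfl | hu
      · exact hw
      · exact hn u hu
    · have hA : ∀ u ∈ L, q w u = 0 ∧ q w (A u) = 0 := by
        intro u hu
        constructor <;> apply hw' <;> rw [List.mem_flatMap] <;> exact ⟨u, hu, by simp⟩
      have hwA : q w (A w) = 0 := by
        have h1 := hsk w w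
        rw [qs] at h1
        linarith
      rw [List.flatMap_cons]
      simp only [List.cons_append, List.nil_append, List.pairwise_cons]
      refine ⟨?_, ?_, hp⟩
      · intro g hg
        rcases List.mem_cons.1 hg with rfl | hg
        · exact hwA
        · exact hw' g hg
      · intro g hg
        rw [List.mem_flatMap] at hg
        obtain ⟨u, hu, hg⟩ := hg
        simp only [List.mem_cons, List.not_mem_nil, or_false] at hg
        rcases hg with rfl | rfl
        · rw [hsk, (hA _ hu).2, neg_zero]
        · rw [hco, (hA _ hu).1, mul_zero]

theorem pairs_prod_apply {n m : ℕ}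
    (C : (Fin m → ℝ) →ₗ[ℝ] Matrix (Fin n) (Fin n) ℝ)
    (q : (Fin m → ℝ) →ₗ[ℝ] (Fin m → ℝ) →ₗ[ℝ] ℝ)
    (A : (Fin m → ℝ) →ₗ[ℝ] (Fin m → ℝ)) (N : ℝ) (hN : N ≠ 0)
    (hCC : ∀ u, C u * C u = q u u • (1 : Matrix (Fin n) (Fin n) ℝ))
    (hAA : ∀ u, A (A u) = -N • u)
    (x v : Fin n → ℝ) (hA : ∀ u, C u *ᵥ v = C (A u) *ᵥ x) (L : List (Fin m → ℝ)) :
    (∀ u ∈ L, q u u ≠ 0) → ∃ c : ℝ, c ≠ 0 ∧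
      ((L.flatMap fun u => [u, A u]).map C).prod *ᵥ x
        = c • (if L.length % 2 = 0 then x else v) := by
  induction L with
  | nil => intro _; exact ⟨1, one_ne_zero, by simp⟩
  | cons u L ih =>
    intro h
    obtain ⟨c, hc, e⟩ := ih (fun g hg => h g (List.mem_cons_of_mem _ hg))
    have hu := h u List.mem_cons_self
    have hx : C u *ᵥ (C (A u) *ᵥ x) = q u u • v := by
      rw [← hA, Matrix.mulVec_mulVec, hCC, Matrix.smul_mulVec, Matrix.one_mulVec]
    have hv : C u *ᵥ (C (A u) *ᵥ v) = (-N * q u u) • x := by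
      rw [hA, hAA, map_smul, Matrix.smul_mulVec, Matrix.mulVec_smul, Matrix.mulVec_mulVec, hCC,
        Matrix.smul_mulVec, Matrix.one_mulVec, smul_smul]
    simp only [List.flatMap_cons, List.cons_append, List.nil_append, List.map_cons,
      List.prod_cons, ← Matrix.mulVec_mulVec, e, List.length_cons, Matrix.mulVec_smul]
    rcases Nat.mod_two_eq_zero_or_one L.length with h0 | h0
    · have h1 : (L.length + 1) % 2 = 1 := by omega
      simp only [h0, h1, if_true, hx]
      exact ⟨c * q u u, mul_ne_zero hc hu, by simp [smul_smul]⟩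
    · have h1 : (L.length + 1) % 2 = 0 := by omega
      simp only [h0, h1, if_true]
      refine ⟨c * (-N * q u u), mul_ne_zero hc (mul_ne_zero (neg_ne_zero.2 hN) hu), ?_⟩
      simp [hv, smul_smul]

theorem core_vol {n m : ℕ}
    (C : (Fin m → ℝ) →ₗ[ℝ] Matrix (Fin n) (Fin n) ℝ)
    (q : (Fin m → ℝ) →ₗ[ℝ] (Fin m → ℝ) →ₗ[ℝ] ℝ)
    (qs : ∀ u w, q u w = q w u) (qn : ∀ u, (∀ w, q u w = 0) → u = 0)
    (A : (Fin m → ℝ) →ₗ[ℝ] (Fin m → ℝ)) (N : ℝ) (hN : N ≠ 0)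
    (hsk : ∀ u w, q (A u) w = -q u (A w)) (hco : ∀ u w, q (A u) (A w) = N * q u w)
    (hC : ∀ u w, C u * C w + C w * C u = (2 * q u w) • (1 : Matrix (Fin n) (Fin n) ℝ))
    (hq : ∀ i j : Fin m, i ≠ j → q (Pi.single i 1) (Pi.single j 1) = 0)
    (x v : Fin n → ℝ) (hA : ∀ u, C u *ᵥ v = C (A u) *ᵥ x) (hm : m % 4 = 0) :
    ∃ d c : ℝ, c ≠ 0 ∧
      d • ((List.ofFn fun i : Fin m => C (Pi.single i 1)).prod *ᵥ x) = c • x := by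
  have hanti : ∀ u w, q u w = 0 → C u * C w = -(C w * C u) := by
    intro u w h
    have := hC u w
    rw [h, mul_zero, zero_smul] at this
    exact eq_neg_of_add_eq_zero_left this
  have hCC : ∀ u, C u * C u = q u u • (1 : Matrix (Fin n) (Fin n) ℝ) := by
    intro u
    have := hC u u
    rw [← two_smul ℝ, mul_smul] at this
    exact smul_right_injective _ (two_ne_zero : (2 : ℝ) ≠ 0) this
  have hAA : ∀ u, A (A u) = -N • u := by
    intro u
    rw [← sub_eq_zero]
    apply qn
    intro w
    rw [map_sub, LinearMap.sub_apply, hsk, hco, map_smul, LinearMap.smul_apply, smul_eq_mul]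
    ring
  obtain ⟨L, hlen, hn, hp⟩ := exists_pairs q qs qn A N hN hsk hco (m / 2) (by omega)
  obtain ⟨c, hc, e⟩ := pairs_prod_apply C q A N hN hCC hAA x v hA L hn
  rw [if_pos (by omega)] at e
  generalize hF : (L.flatMap fun u => [u, A u]) = F at hp e
  have hFl : F.length = m := by
    rw [← hF]; simp [hlen]; omega
  obtain ⟨w, hw⟩ : ∃ w : Fin m → (Fin m → ℝ), F = List.ofFn w := by
    refine ⟨fun i => F.get (i.cast hFl.symm), ?_⟩
    apply List.ext_get
    · simp [hFl]
    · intro k h1 h2; simp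
  subst hw
  rw [List.pairwise_ofFn] at hp
  obtain ⟨d, hd⟩ := prod_eq_smul_of_anticomm C (fun i j hij => hanti _ _ (hq i j hij)) w (by
    intro i j hij
    apply hanti
    rcases lt_or_gt_of_ne hij with h | h
    · exact hp h
    · rw [qs]; exact hp h)
  refine ⟨d, c, hc, ?_⟩
  rw [← e, List.map_ofFn, ← Matrix.smul_mulVec, ← hd]
  rfl

theorem list_prod_norm {n : ℕ} (B : (Fin n → ℝ) → (Fin n → ℝ) → ℝ) (x : Fin n → ℝ)
    (L : List (Matrix (Fin n) (Fin n) ℝ)) :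
    (∀ M ∈ L, ∀ a, B (M *ᵥ a) (M *ᵥ a) = B a a ∨ B (M *ᵥ a) (M *ᵥ a) = -B a a) →
    (B (L.prod *ᵥ x) (L.prod *ᵥ x) = B x x ∨ B (L.prod *ᵥ x) (L.prod *ᵥ x) = -B x x) := by
  induction L with
  | nil => intro _; left; simp
  | cons M L ih =>
    intro h
    have h1 := ih (fun g hg => h g (List.mem_cons_of_mem _ hg))
    have h2 := h M List.mem_cons_self (L.prod *ᵥ x)
    rw [List.prod_cons, ← Matrix.mulVec_mulVec]
    rcases h1 with h1 | h1 <;> rcases h2 with h2 | h2 <;> rw [h2, h1] <;> simp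

theorem psJ_mul_self (n s : ℕ) : psJ n s * psJ n s = 1 := by
  rw [psJ, Matrix.diagonal_mul_diagonal, ← Matrix.diagonal_one]
  congr 1
  funext i
  split_ifs <;> norm_num

theorem psJ_adj (n s : ℕ) (M : Matrix (Fin n) (Fin n) ℝ) (hM : Mᵀ = psJ n s * M * psJ n s)
    (a b : Fin n → ℝ) :
    (M *ᵥ a) ⬝ᵥ (psJ n s *ᵥ b) = a ⬝ᵥ (psJ n s *ᵥ (M *ᵥ b)) := by
  have h : M *ᵥ a = a ᵥ* Mᵀ := (Matrix.vecMul_transpose _ _).symm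
  rw [h, ← Matrix.dotProduct_mulVec, hM, Matrix.mulVec_mulVec, Matrix.mulVec_mulVec, mul_assoc,
    psJ_mul_self, mul_one]

/-- with `m ≡ 0 (mod 4)`, `r ≡ 0 (mod 2)`, `P = P_1 ⋯ P_m` and
`Σ = span{P_1, …, P_m}`: if `x ∈ M₊` and `v` with `⟨v, v⟩ > 0` satisfy: for each
`i ∈ {1, …, m}` there is `Q_i ∈ Σ` with `trace(Q_i P_i) = 0` and `v = Q_i P_i x`,
then `Px = x` or `Px = -x`, i.e. `x ∈ E₊(P) ∪ E₋(P)`. -/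
theorem mem_eigenspace_of_common_kernel (l s m r : ℕ) (hl : 0 < l) (hs : s ≤ 2 * l)
    (hm : 2 ≤ m) (hm4 : m % 4 = 0) (hr : r ≤ m) (hr2 : r % 2 = 0)
    (P : ℕ → Matrix (Fin (2 * l)) (Fin (2 * l)) ℝ)
    (hP : IsCliffordSystem l s m r P)
    (Pm : Matrix (Fin (2 * l)) (Fin (2 * l)) ℝ)
    (hPm : Pm = ((List.range m).map fun k => P (1 + k)).prod)
    (x v : Fin (2 * l) → ℝ)
    (hx1 : psInner (2 * l) s x x = 1)
    (hx2 : ∀ j ∈ Finset.Icc 1 m, psInner (2 * l) s (P j *ᵥ x) x = 0)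
    (hv : 0 < psInner (2 * l) s v v)
    (hQ : ∀ i ∈ Finset.Icc 1 m,
      ∃ Q ∈ Submodule.span ℝ (P '' (Set.Icc 1 m)),
        Matrix.trace (Q * P i) = 0 ∧ v = Q *ᵥ (P i *ᵥ x)) :
    Pm *ᵥ x = x ∨ Pm *ᵥ x = -x := by
  classical
  obtain ⟨hsym, hcl⟩ := hP
  have hIcc : ∀ i : Fin m, 1 + (i : ℕ) ∈ Finset.Icc 1 m := by
    intro i; rw [Finset.mem_Icc]; omega
  let J := psJ (2 * l) s
  let B := Matrix.toBilin' J
  have hB : ∀ a b, psInner (2 * l) s a b = B a b := by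
    intro a b; rw [Matrix.toBilin'_apply']; rfl
  have hBs : ∀ a b, B a b = B b a := by
    intro a b
    simp only [B, Matrix.toBilin'_apply']
    rw [Matrix.dotProduct_mulVec, dotProduct_comm, ← Matrix.mulVec_transpose]
    congr 2
    simp [J, psJ]
  let C : (Fin m → ℝ) →ₗ[ℝ] Matrix (Fin (2 * l)) (Fin (2 * l)) ℝ :=
    Fintype.linearCombination ℝ (fun i : Fin m => P (1 + i))
  have hCdef : ∀ u, C u = ∑ i, u i • P (1 + i) := fun u => Fintype.linearCombination_apply ..
  have hCs : ∀ i : Fin m, C (Pi.single i 1) = P (1 + i) := by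
    intro i; simp [C]
  let e : Fin m → ℝ := fun i => cliffEta r (1 + i) (1 + i)
  have he : ∀ i, e i = 1 ∨ e i = -1 := by
    intro i; simp only [e, cliffEta, if_true]; split_ifs <;> simp
  let q : (Fin m → ℝ) →ₗ[ℝ] (Fin m → ℝ) →ₗ[ℝ] ℝ :=
    LinearMap.mk₂ ℝ (fun u w => ∑ i, e i * u i * w i)
      (by intro u u' w; rw [← Finset.sum_add_distrib]; congr 1; funext i; simp; ring)
      (by intro c u w; rw [smul_eq_mul, Finset.mul_sum]; congr 1; funext i; simp; ring)
      (by intro u w w'; rw [← Finset.sum_add_distrib]; congr 1; funext i; simp; ring)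
      (by intro c u w; rw [smul_eq_mul, Finset.mul_sum]; congr 1; funext i; simp; ring)
  have hq : ∀ u w, q u w = ∑ i, e i * u i * w i := fun u w => rfl
  have qs : ∀ u w, q u w = q w u := by
    intro u w; rw [hq, hq]; congr 1; funext i; ring
  have hqs : ∀ u i, q u (Pi.single i 1) = e i * u i := by
    intro u i; rw [hq]; simp [Pi.single_apply]
  have qn : ∀ u, (∀ w, q u w = 0) → u = 0 := by
    intro u h
    funext i
    have h1 := h (Pi.single i 1)
    rw [hqs] at h1
    rcases he i with h2 | h2 <;> rw [h2] at h1 <;> simpa using h1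
  have hqij : ∀ i j : Fin m, i ≠ j → q (Pi.single i 1) (Pi.single j 1) = 0 := by
    intro i j hij; rw [hqs]; simp [hij.symm]
  have hC : ∀ u w, C u * C w + C w * C u
      = (2 * q u w) • (1 : Matrix (Fin (2 * l)) (Fin (2 * l)) ℝ) := by
    intro u w
    have h1 : C u * C w = ∑ i, ∑ j, (u i * w j) • (P (1 + i) * P (1 + j)) := by
      rw [hCdef, hCdef, Finset.sum_mul_sum]
      simp only [smul_mul_smul_comm]
    have h2 : C w * C u = ∑ i, ∑ j, (u i * w j) • (P (1 + j) * P (1 + i)) := by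
      rw [hCdef, hCdef, Finset.sum_mul_sum, Finset.sum_comm]
      simp only [smul_mul_smul_comm, mul_comm (w _)]
    rw [h1, h2, ← Finset.sum_add_distrib, hq, Finset.mul_sum, Finset.sum_smul]
    apply Finset.sum_congr rfl
    intro i _
    rw [← Finset.sum_add_distrib, Finset.sum_eq_single i]
    · rw [← smul_add, hcl _ (hIcc i) _ (hIcc i), smul_smul]
      congr 1
      simp only [e]; ring
    · intro j _ hj
      rw [← smul_add, hcl _ (hIcc i) _ (hIcc j)]
      have : cliffEta r (1 + i) (1 + j) = 0 := by
        rw [cliffEta, if_neg]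
        intro h
        apply hj
        apply Fin.ext
        omega
      rw [this]; simp
    · simp
  have hadj : ∀ u a b, B (C u *ᵥ a) b = B a (C u *ᵥ b) := by
    intro u a b
    simp only [B, Matrix.toBilin'_apply']
    apply psJ_adj
    rw [hCdef, Matrix.transpose_sum, Finset.mul_sum, Finset.sum_mul]
    apply Finset.sum_congr rfl
    intro i _
    rw [Matrix.transpose_smul, hsym _ (hIcc i), mul_smul_comm, smul_mul_assoc]
  have hCv : ∀ u w a, C u *ᵥ (C w *ᵥ a) + C w *ᵥ (C u *ᵥ a) = (2 * q u w) • a := by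
    intro u w a
    rw [Matrix.mulVec_mulVec, Matrix.mulVec_mulVec, ← Matrix.add_mulVec, hC, Matrix.smul_mulVec,
      Matrix.one_mulVec]
  have hBB : ∀ u w a b, B (C u *ᵥ a) (C w *ᵥ b) + B (C w *ᵥ a) (C u *ᵥ b) = 2 * q u w * B a b := by
    intro u w a b
    rw [hadj, hadj, ← map_add, hCv, map_smul, smul_eq_mul]
  have hB1 : ∀ u w a, B (C u *ᵥ a) (C w *ᵥ a) = q u w * B a a := by
    intro u w a
    have h1 := hBB u w a a
    rw [hBs (C w *ᵥ a)] at h1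
    linarith
  rw [hB] at hx1 hv
  have hQ' : ∀ i : Fin m, ∃ t : Fin m → ℝ, q t (Pi.single i 1) = 0 ∧
      v = C t *ᵥ (C (Pi.single i 1) *ᵥ x) := by
    intro i
    obtain ⟨Q, hQm, htr, hvQ⟩ := hQ _ (hIcc i)
    have hle : Submodule.span ℝ (P '' (Set.Icc 1 m)) ≤ LinearMap.range C := by
      rw [Submodule.span_le]
      rintro _ ⟨k, hk, rfl⟩
      refine ⟨Pi.single ⟨k - 1, by have := hk.1; have := hk.2; omega⟩ 1, ?_⟩
      rw [hCs]
      congr 1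
      have := hk.1
      simp; omega
    obtain ⟨t, rfl⟩ := hle hQm
    rw [← hCs] at htr hvQ
    refine ⟨t, ?_, hvQ⟩
    have h1 := congrArg Matrix.trace (hC t (Pi.single i 1))
    rw [Matrix.trace_add, Matrix.trace_mul_comm (C (Pi.single i 1)), htr, Matrix.trace_smul,
      Matrix.trace_one] at h1
    have h2 : ((2 * l : ℕ) : ℝ) ≠ 0 := by positivity
    simp only [Fintype.card_fin, smul_eq_mul, add_zero] at h1
    have h3 := (mul_eq_zero.1 h1.symm).resolve_right h2
    linarith
  choose t ht hvt using hQ'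
  let A : (Fin m → ℝ) →ₗ[ℝ] (Fin m → ℝ) :=
    Fintype.linearCombination ℝ (fun i : Fin m => -e i • t i)
  have hAi : ∀ i : Fin m, C (Pi.single i 1) *ᵥ v = C (-e i • t i) *ᵥ x := by
    intro i
    have h1 := hCv (Pi.single i 1) (t i) (C (Pi.single i 1) *ᵥ x)
    have h2 := hCv (Pi.single i 1) (Pi.single i 1) x
    rw [qs, ht, mul_zero, zero_smul, ← hvt] at h1
    have h3 : C (Pi.single i 1) *ᵥ (C (Pi.single i 1) *ᵥ x) = e i • x := by
      rw [← two_smul ℝ, mul_smul, hqs] at h2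
      have := smul_right_injective _ (two_ne_zero : (2 : ℝ) ≠ 0) h2
      simpa using this
    rw [h3, Matrix.mulVec_smul] at h1
    rw [map_smul, Matrix.smul_mulVec, neg_smul]
    exact eq_neg_of_add_eq_zero_left h1
  have hA : ∀ u, C u *ᵥ v = C (A u) *ᵥ x := by
    intro u
    have h1 : A u = ∑ i, u i • (-e i • t i) := Fintype.linearCombination_apply ..
    rw [h1, hCdef u, map_sum, Matrix.sum_mulVec, Matrix.sum_mulVec]
    apply Finset.sum_congr rfl
    intro i _
    rw [map_smul, Matrix.smul_mulVec, Matrix.smul_mulVec, ← hAi, hCs]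
  have hvx : B v x = 0 := by
    let i : Fin m := ⟨0, by omega⟩
    rw [hvt i, hadj, hB1, qs, ht, zero_mul]
  have hco : ∀ u w, q (A u) (A w) = B v v * q u w := by
    intro u w
    have h1 := hB1 (A u) (A w) x
    rw [← hA, ← hA, hB1, hx1] at h1
    linarith
  have hsk : ∀ u w, q (A u) w = -q u (A w) := by
    intro u w
    have h1 := hB1 (A u) w x
    have h2 := hB1 (A w) u x
    have h3 := hBB u w v x
    rw [← hA, hx1] at h1 h2
    rw [hvx] at h3
    rw [qs u]
    linarith
  obtain ⟨d, c, hc, h⟩ := core_vol C q qs qn A (B v v) hv.ne' hsk hco hC hqij x v hA hm4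
  have hPm' : Pm = (List.ofFn fun i : Fin m => C (Pi.single i 1)).prod := by
    rw [hPm]
    congr 1
    apply List.ext_getElem
    · simp
    · intro k h1 h2; simp [hCs]
  rw [← hPm'] at h
  have hx0 : x ≠ 0 := by
    rintro rfl; simp at hx1
  have hd : d ≠ 0 := by
    rintro rfl
    rw [zero_smul] at h
    exact (smul_ne_zero hc hx0) h.symm
  have hPx : Pm *ᵥ x = (d⁻¹ * c) • x := by
    rw [mul_smul, ← h, smul_smul, inv_mul_cancel₀ hd, one_smul]
  have hnorm := list_prod_norm (fun a b => B a b) x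
    (List.ofFn fun i : Fin m => C (Pi.single i 1)) (by
      intro M hM a
      rw [List.mem_ofFn] at hM
      obtain ⟨i, rfl⟩ := hM
      simp only [hB1, hqs, Pi.single_eq_same, mul_one]
      rcases he i with h1 | h1 <;> rw [h1] <;> simp)
  rw [← hPm'] at hnorm
  simp only [hPx, map_smul, LinearMap.smul_apply, smul_eq_mul, hx1, mul_one] at hnorm
  rw [hPx]
  have hsq : (d⁻¹ * c) * (d⁻¹ * c) = 1 := by
    rcases hnorm with h1 | h1
    · exact h1
    · nlinarith [mul_self_nonneg (d⁻¹ * c)]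
  rcases mul_self_eq_one_iff.1 hsq with h1 | h1
  · left; rw [h1, one_smul]
  · right; rw [h1, neg_one_smul]
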